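/- Let K be an algebraically closed field of characteristic 0, let η ∈ K be a root of unity with η ≠ 1, let γ ∈ K with γ ≠ 0, and let A = A(1+η, −η, γ) be the down-up algebra. Then every finite-dimensional left A-module is semisimple. -/

import Mathlib

noncomputable section

/-- The defining relations of the down-up algebra `A(α,β,γ)`:
generator `0` is `d`, generator `1` is `u`. -/
inductive DownUpRel (K : Type) [Field K] (α β γ : K) :
    FreeAlgebra K (Fin 2) → FreeAlgebra K (Fin 2) → Prop
  | rel1 : DownUpRel K α β γ
      (FreeAlgebra.ι K 0 * FreeAlgebra.ι K 0 * FreeAlgebra.ι K 1)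
      (α • (FreeAlgebra.ι K 0 * FreeAlgebra.ι K 1 * FreeAlgebra.ι K 0) +
        β • (FreeAlgebra.ι K 1 * FreeAlgebra.ι K 0 * FreeAlgebra.ι K 0) +
        γ • FreeAlgebra.ι K 0)
  | rel2 : DownUpRel K α β γ
      (FreeAlgebra.ι K 0 * FreeAlgebra.ι K 1 * FreeAlgebra.ι K 1)
      (α • (FreeAlgebra.ι K 1 * FreeAlgebra.ι K 0 * FreeAlgebra.ι K 1) +
        β • (FreeAlgebra.ι K 1 * FreeAlgebra.ι K 1 * FreeAlgebra.ι K 0) +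
        γ • FreeAlgebra.ι K 1)

/-- The down-up algebra `A(α,β,γ)`. -/
abbrev DownUp (K : Type) [Field K] (α β γ : K) := RingQuot (DownUpRel K α β γ)

/-- The generator `d` of the down-up algebra. -/
def DownUp.d (K : Type) [Field K] (α β γ : K) : DownUp K α β γ :=
  RingQuot.mkAlgHom K (DownUpRel K α β γ) (FreeAlgebra.ι K 0)

/-- The generator `u` of the down-up algebra. -/
def DownUp.u (K : Type) [Field K] (α β γ : K) : DownUp K α β γ :=
  RingQuot.mkAlgHom K (DownUpRel K α β γ) (FreeAlgebra.ι K 1)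

section RootOfUnity

open Polynomial

variable {K : Type*} [Field K] [CharZero K]

/-- A root of unity and its inverse satisfy the same rational polynomial equations. -/
theorem aeval_inv_eq_zero_of_pow_eq_one {q : K} {n : ℕ} (hn : 0 < n) (hq : q ^ n = 1)
    {p : ℚ[X]} (hp : aeval q p = 0) : aeval q⁻¹ p = 0 := by
  have hpos : 0 < orderOf q := orderOf_pos_iff.2 (isOfFinOrder_iff_pow_eq_one.2 ⟨n, hn, hq⟩)
  have h := IsPrimitiveRoot.orderOf q
  have hdvd : minpoly ℚ q⁻¹ ∣ p := by
    rw [← cyclotomic_eq_minpoly_rat h.inv hpos, cyclotomic_eq_minpoly_rat h hpos]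
    exact minpoly.dvd ℚ q hp
  exact (minpoly.dvd_iff).1 hdvd

/-- For a root of unity `q`, the numbers `k / (q ^ k - 1)` (`k` positive) are pairwise distinct. -/
theorem eq_of_natCast_mul_pow_sub_one {q : K} {n : ℕ} (hn : 0 < n) (hq : q ^ n = 1) {k m : ℕ}
    (hmpos : 0 < m) (hqk : q ^ k ≠ 1) (h : (k : K) * (q ^ m - 1) = m * (q ^ k - 1)) : k = m := by
  have hq0 : q ≠ 0 := by
    rintro rfl
    simp [hn.ne'] at hq
  have hinv : (k : K) * (q⁻¹ ^ m - 1) = m * (q⁻¹ ^ k - 1) := by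
    have := aeval_inv_eq_zero_of_pow_eq_one hn hq
      (p := (k : ℚ[X]) * (X ^ m - 1) - (m : ℚ[X]) * (X ^ k - 1)) (by simp [h])
    simpa [sub_eq_zero] using this
  have hk1 : q ^ k - 1 ≠ 0 := sub_ne_zero.2 hqk
  have hm : (k : K) * (q ^ m - 1) * q ^ k = m * (q ^ k - 1) * q ^ m := by
    have hk0 : q ^ k ≠ 0 := pow_ne_zero _ hq0
    have hm0 : q ^ m ≠ 0 := pow_ne_zero _ hq0
    rw [inv_pow, inv_pow] at hinv
    field_simp at hinv
    linear_combination -hinv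
  have hpow : q ^ k = q ^ m := by
    have hm0 : (m : K) * (q ^ k - 1) ≠ 0 := mul_ne_zero (by exact_mod_cast hmpos.ne') hk1
    refine mul_left_cancel₀ hm0 ?_
    rw [← hm, h]
  rw [← hpow] at h
  exact_mod_cast mul_right_cancel₀ hk1 h

end RootOfUnity

/-- An endomorphism `T` with `X T = T X + e T`, `e ≠ 0`, of a finite-dimensional vector space in
characteristic zero is nilpotent. -/
theorem Module.End.isNilpotent_of_commutator_eq_smul {K V : Type*} [Field K] [CharZero K]
    [AddCommGroup V] [Module K V] [FiniteDimensional K V] {X T : Module.End K V} {e : K}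
    (he : e ≠ 0) (h : X * T = T * X + e • T) : IsNilpotent T := by
  by_contra hT
  have hpow (k : ℕ) : X * T ^ k = T ^ k * X + (k * e) • T ^ k := by
    induction k with
    | zero => simp
    | succ k ih =>
      rw [pow_succ, ← mul_assoc, ih, add_mul, mul_assoc, h, mul_add, smul_mul_assoc,
        mul_smul_comm, ← mul_assoc, add_assoc, ← add_smul]
      push_cast
      ring_nf
  let ad : Module.End K (Module.End K V) := LinearMap.mulLeft K X - LinearMap.mulRight K X
  have hev (k : ℕ) : ad.HasEigenvalue (k * e) := by
    refine Module.End.hasEigenvalue_of_hasEigenvector (x := T ^ k)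
      (Module.End.hasEigenvector_iff.2 ⟨Module.End.mem_eigenspace_iff.2 ?_, fun h0 => hT ⟨k, h0⟩⟩)
    simp [ad, hpow]
  refine Set.infinite_of_injective_forall_mem (f := fun k : ℕ => (k : K) * e) (fun a b hab => ?_)
    hev ad.finite_hasEigenvalue
  exact_mod_cast mul_right_cancel₀ he hab

/-- A nonzero subspace stable under an endomorphism contains an eigenvector. -/
theorem Module.End.exists_eigenvector_mem {K V : Type*} [Field K] [IsAlgClosed K]
    [AddCommGroup V] [Module K V] [FiniteDimensional K V] (f : Module.End K V)
    {P : Submodule K V} (hP : ∀ v ∈ P, f v ∈ P) (hne : P ≠ ⊥) :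
    ∃ t : K, ∃ v ∈ P, v ≠ 0 ∧ f v = t • v := by
  have : Nontrivial P := Submodule.nontrivial_iff_ne_bot.2 hne
  obtain ⟨t, ht⟩ := Module.End.exists_eigenvalue (f.restrict hP)
  obtain ⟨v, hv⟩ := ht.exists_hasEigenvector
  refine ⟨t, v, v.2, by simpa using hv.2, ?_⟩
  simpa using congrArg Subtype.val hv.apply_eq_smul

/-- If `f` is stable on `P` and its generalized eigenvectors of rank two in `P` are eigenvectors,
then `P` is spanned by eigenvectors. -/
theorem Module.End.le_iSup_inf_eigenspace {K V : Type*} [Field K] [IsAlgClosed K]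
    [AddCommGroup V] [Module K V] [FiniteDimensional K V] (f : Module.End K V)
    {P : Submodule K V} (hP : ∀ v ∈ P, f v ∈ P)
    (h : ∀ t : K, ∀ v ∈ P, f (f v - t • v) = t • (f v - t • v) → f v = t • v) :
    P ≤ ⨆ t : K, P ⊓ f.eigenspace t := by
  have key (t : K) (k : ℕ) : ∀ v ∈ P, ((f - algebraMap K _ t) ^ k) v = 0 → f v = t • v := by
    induction k with
    | zero =>
      intro v _ hv
      simp only [pow_zero, Module.End.one_apply] at hv
      simp [hv]
    | succ k ih =>
      intro v hv hk
      refine h t v hv (ih _ (P.sub_mem (hP v hv) (P.smul_mem t hv)) ?_)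
      simpa [pow_succ] using hk
  intro v hv
  let g : Module.End K P := f.restrict hP
  have htop := Module.End.iSup_maxGenEigenspace_eq_top g
  have hmem : (⟨v, hv⟩ : P) ∈ ⨆ t, g.maxGenEigenspace t := htop ▸ Submodule.mem_top
  have hle : ⨆ t, g.maxGenEigenspace t ≤
      (⨆ t : K, P ⊓ f.eigenspace t).comap P.subtype := by
    refine iSup_le fun t w hw => ?_
    obtain ⟨k, hk⟩ := (Module.End.mem_maxGenEigenspace _ _ _).1 hw
    refine Submodule.mem_iSup_of_mem t ⟨w.2, Module.End.mem_eigenspace_iff.2 (key t k w w.2 ?_)⟩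
    have hpow (j : ℕ) (x : P) : (((g - t • (1 : Module.End K P)) ^ j) x : V) =
        ((f - algebraMap K _ t) ^ j) (x : V) := by
      induction j generalizing x with
      | zero => simp
      | succ j ih => simp [pow_succ, ih, g]
    rw [← hpow, hk]
    rfl
  exact hle hmem

/-- Operators `D`, `U`, `W` with `[D, U] = c + W`, `D W = q W D` and `W U = q U W`, where `c ≠ 0`
and `q ≠ 1` is a root of unity. -/
structure IsDownUpTriple {K V : Type*} [Field K] [AddCommGroup V] [Module K V] (c q : K)
    (D U W : Module.End K V) : Prop where
  ne_zero : c ≠ 0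
  ne_one : q ≠ 1
  exists_pow : ∃ n : ℕ, 0 < n ∧ q ^ n = 1
  down_up : ∀ v, D (U v) = U (D v) + c • v + W v
  down_weight : ∀ v, D (W v) = q • W (D v)
  weight_up : ∀ v, W (U v) = q • U (W v)

namespace IsDownUpTriple

/-- The scalar by which `U D` acts on `U ^ k v` when `U D v = 0` and `W v = t v`. -/
def coeff {K : Type*} [Field K] (c q : K) (k : ℕ) (t : K) : K :=
  k * c + (∑ i ∈ Finset.range k, q ^ i) * t

section Coeff

variable {K : Type*} [Field K] {c q : K}

theorem coeff_add (m j : ℕ) (t : K) :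
    coeff c q (m + j) t = coeff c q m t + coeff c q j (q ^ m * t) := by
  simp only [coeff, Finset.sum_range_add, pow_add, ← Finset.mul_sum]
  push_cast
  ring

theorem coeff_succ (k : ℕ) (t : K) :
    coeff c q (k + 1) t = coeff c q k t + (c + q ^ k * t) := by
  rw [coeff_add]
  simp [coeff]

theorem sum_ne_zero_of_coeff_eq_zero [CharZero K] (hc : c ≠ 0) {k : ℕ} (hk : 0 < k) {t : K}
    (h : coeff c q k t = 0) : ∑ i ∈ Finset.range k, q ^ i ≠ 0 := by
  intro h0
  have : (k : K) ≠ 0 := by exact_mod_cast hk.ne'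
  simp [coeff, h0, hc, this] at h

theorem coeff_unique [CharZero K] (hc : c ≠ 0) (hq1 : q ≠ 1) {n : ℕ} (hn : 0 < n)
    (hq : q ^ n = 1) {k m : ℕ} (hk : 0 < k) (hm : 0 < m) {t : K} (hkt : coeff c q k t = 0)
    (hmt : coeff c q m t = 0) : k = m := by
  have hsum := sum_ne_zero_of_coeff_eq_zero hc hk hkt
  have hgk := geom_sum_mul q k
  have hgm := geom_sum_mul q m
  have hq1' : q - 1 ≠ 0 := sub_ne_zero.2 hq1
  refine eq_of_natCast_mul_pow_sub_one hn hq hm ?_ ?_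
  · rw [← sub_ne_zero, ← hgk]
    exact mul_ne_zero hsum hq1'
  · rw [← hgk, ← hgm]
    refine mul_left_cancel₀ hc ?_
    simp only [coeff] at hkt hmt
    linear_combination (q - 1) * (∑ i ∈ Finset.range m, q ^ i) * hkt -
      (q - 1) * (∑ i ∈ Finset.range k, q ^ i) * hmt

end Coeff

variable {K V : Type*} [Field K] [AddCommGroup V] [Module K V] {c q : K} {D U W : Module.End K V}

theorem q_ne_zero (h : IsDownUpTriple c q D U W) : q ≠ 0 := by
  rintro rfl
  obtain ⟨n, hn, h1⟩ := h.exists_pow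
  simp [hn.ne'] at h1

theorem weight_down (h : IsDownUpTriple c q D U W) (v : V) : W (D v) = q⁻¹ • D (W v) := by
  rw [h.down_weight, inv_smul_smul₀ h.q_ne_zero]

/-- Exchanging the two generators. -/
theorem swap (h : IsDownUpTriple c q D U W) : IsDownUpTriple (-c) q⁻¹ U D (-W) where
  ne_zero := neg_ne_zero.2 h.ne_zero
  ne_one := inv_ne_one.2 h.ne_one
  exists_pow := by
    obtain ⟨n, hn, h1⟩ := h.exists_pow
    exact ⟨n, hn, by simp [h1]⟩
  down_up v := by
    simp only [h.down_up, LinearMap.neg_apply]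
    module
  down_weight v := by
    simp [h.weight_up, inv_smul_smul₀ h.q_ne_zero]
  weight_up v := by
    simp [h.weight_down]

theorem coeff_ne_zero [CharZero K] (h : IsDownUpTriple c q D U W) {k m : ℕ} {t : K}
    (hm : 0 < m) (hmt : coeff c q m t = 0) (hk : 0 < k) (hkm : k ≠ m) : coeff c q k t ≠ 0 := by
  obtain ⟨n, hn, h1⟩ := h.exists_pow
  exact fun hkt => hkm (coeff_unique h.ne_zero h.ne_one hn h1 hk hm hkt hmt)

theorem isNilpotent_down [CharZero K] [FiniteDimensional K V] (h : IsDownUpTriple c q D U W) :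
    IsNilpotent D := by
  obtain ⟨n, hn, h1⟩ := h.exists_pow
  have hpow (k : ℕ) (v : V) : (D ^ k) (U (D v)) = U (D ((D ^ k) v)) + (k * c) • (D ^ k) v +
      (∑ i ∈ Finset.range k, q ^ i) • W ((D ^ k) v) := by
    induction k with
    | zero => simp
    | succ k ih =>
      rw [pow_succ', Module.End.mul_apply, ih, Module.End.mul_apply, map_add, map_add, h.down_up,
        map_smul, map_smul, h.down_weight, Finset.sum_range_succ']
      simp only [pow_succ, ← Finset.sum_mul]
      push_cast
      module
  have hsum : ∑ i ∈ Finset.range n, q ^ i = 0 := by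
    have := geom_sum_mul q n
    rw [h1, sub_self] at this
    exact (mul_eq_zero.1 this).resolve_right (sub_ne_zero.2 h.ne_one)
  have hnc : -((n : K) * c) ≠ 0 :=
    neg_ne_zero.2 (mul_ne_zero (by exact_mod_cast hn.ne') h.ne_zero)
  have hnil : IsNilpotent (D ^ n) := by
    refine Module.End.isNilpotent_of_commutator_eq_smul (X := U * D) hnc ?_
    ext v
    have := hpow n v
    simp only [Module.End.mul_apply, LinearMap.add_apply, LinearMap.smul_apply, this, hsum]
    module
  exact hnil.of_pow

theorem isNilpotent_up [CharZero K] [FiniteDimensional K V] (h : IsDownUpTriple c q D U W) :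
    IsNilpotent U :=
  h.swap.isNilpotent_down

theorem weight_pow_up (h : IsDownUpTriple c q D U W) (k : ℕ) (v : V) :
    W ((U ^ k) v) = q ^ k • (U ^ k) (W v) := by
  induction k with
  | zero => simp
  | succ k ih =>
    rw [pow_succ', Module.End.mul_apply, h.weight_up, ih, map_smul, smul_smul, pow_succ',
      Module.End.mul_apply]

theorem up_down_pow_up (h : IsDownUpTriple c q D U W) {v : V} (hv : U (D v) = 0) (k : ℕ) :
    U (D ((U ^ k) v)) = (U ^ k) ((k * c) • v + (∑ i ∈ Finset.range k, q ^ i) • W v) := by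
  induction k with
  | zero => simp [hv]
  | succ k ih =>
    rw [pow_succ', Module.End.mul_apply, h.down_up, ih, h.weight_pow_up, Finset.sum_range_succ]
    simp only [Module.End.mul_apply, map_add, map_smul]
    push_cast
    module

theorem down_pow_up (h : IsDownUpTriple c q D U W) {v : V} (hv : U (D v) = 0) (k : ℕ) :
    D ((U ^ (k + 1)) v) =
      (U ^ k) (((k + 1 : ℕ) * c) • v + (∑ i ∈ Finset.range (k + 1), q ^ i) • W v) := by
  rw [pow_succ', Module.End.mul_apply, h.down_up, h.up_down_pow_up hv, h.weight_pow_up,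
    Finset.sum_range_succ]
  simp only [map_add, map_smul]
  push_cast
  module

theorem down_pow_up_of_weight (h : IsDownUpTriple c q D U W) {v : V} {t : K} (hv : U (D v) = 0)
    (hw : W v = t • v) (k : ℕ) : D ((U ^ (k + 1)) v) = coeff c q (k + 1) t • (U ^ k) v := by
  rw [h.down_pow_up hv, hw, ← map_smul, coeff]
  congr 1
  module

theorem pow_up_eq_zero [CharZero K] [FiniteDimensional K V] (h : IsDownUpTriple c q D U W) {v : V}
    {r : ℕ} {a : ℕ → K} (ha : ∀ k, r ≤ k → a k ≠ 0)
    (hv : ∀ k, r ≤ k → D ((U ^ (k + 1)) v) = a k • (U ^ k) v) : (U ^ r) v = 0 := by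
  obtain ⟨N, hN⟩ := h.isNilpotent_up
  have hstep (j : ℕ) (hj : (U ^ (r + j)) v = 0) : (U ^ r) v = 0 := by
    induction j with
    | zero => exact hj
    | succ j ih =>
      refine ih ?_
      have := hv (r + j) (by omega)
      rw [add_assoc, hj, map_zero] at this
      exact (smul_eq_zero.1 this.symm).resolve_left (ha _ (by omega))
  exact hstep N (by rw [pow_add, hN]; simp)

/-- A weight vector killed by `D` generates a chain of length `m` determined by its weight. -/
theorem exists_length [CharZero K] [FiniteDimensional K V] (h : IsDownUpTriple c q D U W) {v : V}
    {t : K} (hv0 : v ≠ 0) (hv : D v = 0) (hw : W v = t • v) :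
    ∃ m : ℕ, 0 < m ∧ coeff c q m t = 0 ∧ (U ^ m) v = 0 := by
  have hUD : U (D v) = 0 := by simp [hv]
  obtain ⟨m, hm, hmt⟩ : ∃ m : ℕ, 0 < m ∧ coeff c q m t = 0 := by
    by_contra! hne
    refine hv0 ?_
    simpa using h.pow_up_eq_zero (v := v) (r := 0) (a := fun k => coeff c q (k + 1) t)
      (fun k _ => hne _ (by omega)) fun k _ => h.down_pow_up_of_weight hUD hw k
  exact ⟨m, hm, hmt, h.pow_up_eq_zero (a := fun k => coeff c q (k + 1) t)
    (fun k hk => h.coeff_ne_zero hm hmt (by omega) (by omega))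
    fun k _ => h.down_pow_up_of_weight hUD hw k⟩

theorem pow_up_ne_zero [CharZero K] (h : IsDownUpTriple c q D U W) {v : V}
    {t : K} (hv0 : v ≠ 0) (hv : D v = 0) (hw : W v = t • v) {m : ℕ} (hm : 0 < m)
    (hmt : coeff c q m t = 0) {k : ℕ} (hk : k < m) : (U ^ k) v ≠ 0 := by
  induction k with
  | zero => simpa using hv0
  | succ k ih =>
    intro h0
    have := h.down_pow_up_of_weight (by simp [hv]) hw k
    rw [h0, map_zero] at this
    exact smul_ne_zero (h.coeff_ne_zero hm hmt (by omega) (by omega)) (ih (by omega)) this.symm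

/-- `U` is injective on the range of `D`. -/
theorem down_eq_zero [CharZero K] [IsAlgClosed K] [FiniteDimensional K V]
    (h : IsDownUpTriple c q D U W) {z : V} (hz : U (D z) = 0) : D z = 0 := by
  by_contra hne
  have hP : LinearMap.ker U ⊓ LinearMap.range D ≠ ⊥ := fun hbot =>
    hne ((Submodule.mem_bot K).1 (hbot ▸ ⟨hz, z, rfl⟩))
  obtain ⟨s, _, ⟨hUy, z, rfl⟩, hy0, hWy⟩ := Module.End.exists_eigenvector_mem W
    (P := LinearMap.ker U ⊓ LinearMap.range D) (by
      rintro _ ⟨hU, x, rfl⟩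
      refine ⟨?_, ?_⟩
      · have := h.weight_up (D x)
        rw [LinearMap.mem_ker.1 hU, map_zero] at this
        exact (smul_eq_zero.1 this.symm).resolve_left h.q_ne_zero
      · exact ⟨q⁻¹ • W x, by rw [h.weight_down, map_smul]⟩) hP
  replace hUy : U (D z) = 0 := hUy
  obtain ⟨j, hj, hjs, -⟩ := h.swap.exists_length (t := -s) hy0 hUy (by simp [hWy])
  obtain ⟨l, hl, hjl⟩ : ∃ l : K, q * s = q ^ j * l ∧ coeff c q j l = 0 := by
    obtain ⟨i, rfl⟩ : ∃ i, j = i + 1 := ⟨j - 1, by omega⟩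
    have hq := h.q_ne_zero
    refine ⟨(q ^ i)⁻¹ * s, by field_simp; ring, ?_⟩
    have hsum : ∑ k ∈ Finset.range (i + 1), q⁻¹ ^ k =
        (∑ k ∈ Finset.range (i + 1), q ^ k) * (q ^ i)⁻¹ := by
      rw [← Finset.sum_range_reflect, Finset.sum_mul]
      refine Finset.sum_congr rfl fun k hk => ?_
      have hk' : k ≤ i := by simpa [Nat.lt_succ_iff] using hk
      rw [show i + 1 - 1 - k = i - k by omega, inv_pow, pow_sub₀ q hq hk']
      field_simp
    rw [coeff, hsum] at hjs
    rw [coeff]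
    linear_combination -hjs
  have hcoeff {m : ℕ} (hm : 0 < m) : coeff c q m (q * s) ≠ 0 := by
    have := h.coeff_ne_zero hj hjl (k := j + m) (by omega) (by omega)
    rwa [coeff_add, hjl, zero_add, ← hl] at this
  let T : Module.End K V := W - algebraMap K _ (q * s)
  have hTapply (v : V) : T v = W v - (q * s) • v := by
    simp [T, Module.algebraMap_end_apply, -map_mul]
  have hTker : ∀ v ∈ LinearMap.ker D, T v ∈ LinearMap.ker D := by
    intro v hv
    rw [LinearMap.mem_ker] at hv ⊢
    rw [hTapply, map_sub, map_smul, h.down_weight, hv]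
    simp
  have hinj : Function.Injective (T.restrict hTker) := by
    rw [← LinearMap.ker_eq_bot, LinearMap.ker_eq_bot']
    rintro ⟨v, hv⟩ hTv
    have hTv' : W v = (q * s) • v := by
      have := congrArg Subtype.val hTv
      simpa [hTapply, sub_eq_zero] using this
    by_contra hv0
    obtain ⟨m, hm, hmt, -⟩ := h.exists_length (v := v) (by simpa using hv0) hv hTv'
    exact hcoeff hm hmt
  obtain ⟨⟨w, hw⟩, hTw⟩ := LinearMap.surjective_of_injective hinj ⟨T z, by
    rw [LinearMap.mem_ker, hTapply, map_sub, map_smul, h.down_weight, hWy, smul_smul, sub_self]⟩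
  rw [LinearMap.mem_ker] at hw
  replace hTw : T w = T z := congrArg Subtype.val hTw
  have hWzw : W (z - w) = (q * s) • (z - w) := by
    have : T (z - w) = 0 := by rw [map_sub, hTw, sub_self]
    rwa [hTapply, sub_eq_zero] at this
  have hUDzw : U (D (z - w)) = 0 := by rw [map_sub, hw, sub_zero, hUy]
  have hzw : z - w = 0 := by
    simpa using h.pow_up_eq_zero (r := 0) (a := fun k => coeff c q (k + 1) (q * s))
      (fun k _ => hcoeff (by omega)) fun k _ => h.down_pow_up_of_weight hUDzw hWzw k
  rw [sub_eq_zero] at hzw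
  exact hy0 (by rw [hzw, hw])

theorem ker_down_sup_range_up [CharZero K] [IsAlgClosed K] [FiniteDimensional K V]
    (h : IsDownUpTriple c q D U W) : LinearMap.ker D ⊔ LinearMap.range U = ⊤ := by
  have hdisj : Disjoint (LinearMap.ker (U * D)) (LinearMap.range (U * D)) := by
    rw [Submodule.disjoint_def]
    rintro _ hx ⟨z, rfl⟩
    exact h.swap.down_eq_zero (h.down_eq_zero hx)
  have htop := Submodule.eq_top_of_disjoint _ _
    (by rw [add_comm, LinearMap.finrank_range_add_finrank_ker]) hdisj
  rw [eq_top_iff, ← htop]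
  refine sup_le_sup (fun v hv => h.down_eq_zero hv) ?_
  rintro _ ⟨z, rfl⟩
  exact ⟨D z, rfl⟩

/-- A subspace stable under `U` and containing the kernel of `D` is the whole space. -/
theorem eq_top_of_ker_down_le [CharZero K] [IsAlgClosed K] [FiniteDimensional K V]
    (h : IsDownUpTriple c q D U W) {S : Submodule K V} (hU : ∀ v ∈ S, U v ∈ S)
    (hD : LinearMap.ker D ≤ S) : S = ⊤ := by
  obtain ⟨N, hN⟩ := h.isNilpotent_up
  have key (k : ℕ) (v : V) : ∃ s ∈ S, ∃ w, v = s + (U ^ k) w := by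
    induction k with
    | zero => exact ⟨0, S.zero_mem, v, by simp⟩
    | succ k ih =>
      obtain ⟨s, hs, w, rfl⟩ := ih
      obtain ⟨a, ha, _, ⟨b, rfl⟩, rfl⟩ :=
        Submodule.mem_sup.1 (h.ker_down_sup_range_up ▸ Submodule.mem_top (x := w))
      refine ⟨s + (U ^ k) a, S.add_mem hs ?_, b, ?_⟩
      · have hpow (j : ℕ) : (U ^ j) a ∈ S := by
          induction j with
          | zero => exact hD ha
          | succ j ihj =>
            rw [pow_succ', Module.End.mul_apply]
            exact hU _ ihj
        exact hpow k
      · simp [pow_succ, add_assoc]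
  refine eq_top_iff.2 fun v _ => ?_
  obtain ⟨s, hs, w, rfl⟩ := key N v
  simpa [hN] using hs

theorem weight_mem_ker_down (h : IsDownUpTriple c q D U W) (v : V) (hv : v ∈ LinearMap.ker D) :
    W v ∈ LinearMap.ker D := by
  rw [LinearMap.mem_ker] at hv ⊢
  rw [h.down_weight, hv, map_zero, smul_zero]

/-- The kernel of `D` is spanned by weight vectors. -/
theorem ker_down_le_iSup [CharZero K] [IsAlgClosed K] [FiniteDimensional K V]
    (h : IsDownUpTriple c q D U W) :
    LinearMap.ker D ≤ ⨆ t : K, LinearMap.ker D ⊓ W.eigenspace t := by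
  refine Module.End.le_iSup_inf_eigenspace W h.weight_mem_ker_down fun t v hv hw => ?_
  by_contra hne
  set v₁ := W v - t • v with hv₁
  have hWv : W v = t • v + v₁ := by rw [hv₁]; abel
  have hv₁0 : v₁ ≠ 0 := sub_ne_zero.2 hne
  have hDv₁ : D v₁ = 0 :=
    Submodule.sub_mem _ (h.weight_mem_ker_down v hv) (Submodule.smul_mem _ t hv)
  have hUDv : U (D v) = 0 := by rw [LinearMap.mem_ker.1 hv, map_zero]
  obtain ⟨m, hm, hmt, hUm⟩ := h.exists_length hv₁0 hDv₁ hw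
  have hD (k : ℕ) : D ((U ^ (k + 1)) v) = coeff c q (k + 1) t • (U ^ k) v +
      (∑ i ∈ Finset.range (k + 1), q ^ i) • (U ^ k) v₁ := by
    rw [h.down_pow_up hUDv, hWv, ← map_smul, ← map_smul, ← map_add, coeff]
    congr 1
    module
  have hUv : (U ^ m) v = 0 := by
    refine h.pow_up_eq_zero (a := fun k => coeff c q (k + 1) t)
      (fun k hk => h.coeff_ne_zero hm hmt (by omega) (by omega)) fun k hk => ?_
    rw [hD, ← Nat.sub_add_cancel hk, pow_add, Module.End.mul_apply _ _ v₁, hUm]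
    simp
  obtain ⟨i, rfl⟩ : ∃ i, m = i + 1 := ⟨m - 1, by omega⟩
  have := hD i
  rw [hUv, hmt, map_zero, zero_smul, zero_add] at this
  exact smul_ne_zero (sum_ne_zero_of_coeff_eq_zero h.ne_zero hm hmt)
    (h.pow_up_ne_zero hv₁0 hDv₁ hw hm hmt (Nat.lt_succ_self i)) this.symm

/-- The span of the vectors `U ^ k v`. -/
def chain (U : Module.End K V) (v : V) : Submodule K V :=
  Submodule.span K (Set.range fun k : ℕ => (U ^ k) v)

theorem self_mem_chain (v : V) : v ∈ chain U v :=
  Submodule.subset_span ⟨0, by simp⟩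

theorem up_mem_chain {v x : V} (hx : x ∈ chain U v) : U x ∈ chain U v := by
  have : chain U v ≤ (chain U v).comap U := by
    refine Submodule.span_le.2 ?_
    rintro _ ⟨k, rfl⟩
    exact Submodule.subset_span ⟨k + 1, by simp [pow_succ']⟩
  exact this hx

theorem down_mem_chain (h : IsDownUpTriple c q D U W) {v : V} {t : K} (hv : D v = 0)
    (hw : W v = t • v) {x : V} (hx : x ∈ chain U v) : D x ∈ chain U v := by
  have : chain U v ≤ (chain U v).comap D := by
    refine Submodule.span_le.2 ?_
    rintro _ ⟨k, rfl⟩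
    cases k with
    | zero => simp [hv]
    | succ k =>
      simp only [Submodule.comap_coe, Set.mem_preimage, SetLike.mem_coe]
      rw [h.down_pow_up_of_weight (by simp [hv]) hw k]
      exact Submodule.smul_mem _ _ (Submodule.subset_span ⟨k, rfl⟩)
  exact this hx

/-- A subspace stable under `D` and containing a nonzero vector of the chain of `v` contains
`v`. -/
theorem mem_of_mem_chain [CharZero K] [FiniteDimensional K V] (h : IsDownUpTriple c q D U W)
    {v : V} {t : K} (hv : D v = 0) (hw : W v = t • v) {S : Submodule K V}
    (hS : ∀ x ∈ S, D x ∈ S) {x : V} (hx : x ∈ chain U v) (hx0 : x ≠ 0) (hxS : x ∈ S) :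
    v ∈ S := by
  rcases eq_or_ne v 0 with rfl | hv0
  · exact S.zero_mem
  obtain ⟨m, hm, hmt, hUm⟩ := h.exists_length hv0 hv hw
  have hUD : U (D v) = 0 := by simp [hv]
  let F (r : ℕ) : Submodule K V := Submodule.span K ((fun k : ℕ => (U ^ k) v) '' Set.Iio r)
  have hFD (r : ℕ) {y : V} (hy : y ∈ F (r + 1)) : D y ∈ F r := by
    have : F (r + 1) ≤ (F r).comap D := by
      refine Submodule.span_le.2 ?_
      rintro _ ⟨k, hk, rfl⟩
      cases k with
      | zero => simp [hv]
      | succ k =>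
        simp only [Submodule.comap_coe, Set.mem_preimage, SetLike.mem_coe]
        rw [h.down_pow_up_of_weight hUD hw k]
        exact Submodule.smul_mem _ _ (Submodule.subset_span ⟨k, by simpa using hk, rfl⟩)
    exact this hy
  have hlead (r : ℕ) (hr : r < m) :
      ∀ y ∈ F r, ∀ a : K, a ≠ 0 → a • (U ^ r) v + y ∈ S → v ∈ S := by
    induction r with
    | zero =>
      intro y hy a ha hay
      obtain rfl : y = 0 := by simpa [F] using hy
      rw [pow_zero, Module.End.one_apply, add_zero] at hay
      exact (S.smul_mem_iff ha).1 hay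
    | succ r ih =>
      intro y hy a ha hay
      refine ih (by omega) (D y) (hFD r hy) (a * coeff c q (r + 1) t)
        (mul_ne_zero ha (h.coeff_ne_zero hm hmt (by omega) (by omega))) ?_
      have := hS _ hay
      rwa [map_add, map_smul, h.down_pow_up_of_weight hUD hw, smul_smul] at this
  have hFv (r : ℕ) (hr : r ≤ m) : ∀ y ∈ F r, y ≠ 0 → y ∈ S → v ∈ S := by
    induction r with
    | zero =>
      intro y hy hy0
      exact absurd (by simpa [F] using hy) hy0
    | succ r ih =>
      intro y hy hy0 hyS
      have hIio : Set.Iio (r + 1) = insert r (Set.Iio r) := by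
        ext k
        simp only [Set.mem_Iio, Set.mem_insert_iff]
        omega
      simp only [F, hIio, Set.image_insert_eq] at hy
      obtain ⟨a, z, hz, rfl⟩ := Submodule.mem_span_insert.1 hy
      by_cases ha : a = 0
      · rw [ha, zero_smul, zero_add] at hy0 hyS
        exact ih (by omega) z hz hy0 hyS
      · exact hlead r (by omega) z hz a ha hyS
  have hchain : chain U v ≤ F m := by
    refine Submodule.span_le.2 ?_
    rintro _ ⟨k, rfl⟩
    rcases lt_or_ge k m with hk | hk
    · exact Submodule.subset_span ⟨k, hk, rfl⟩
    · have : (U ^ k) v = 0 := by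
        rw [← Nat.sub_add_cancel hk, pow_add, Module.End.mul_apply, hUm, map_zero]
      simp [this]
  exact hFv m le_rfl x (hchain hx) hx0 hxS

end IsDownUpTriple

namespace DownUp

variable {K : Type} [Field K] {α β γ : K}

theorem d_mul_d_mul_u : d K α β γ * d K α β γ * u K α β γ =
    α • (d K α β γ * u K α β γ * d K α β γ) + β • (u K α β γ * d K α β γ * d K α β γ) +
      γ • d K α β γ := by
  simpa [d, u] using RingQuot.mkAlgHom_rel K (DownUpRel.rel1 (K := K) (α := α) (β := β) (γ := γ))

theorem d_mul_u_mul_u : d K α β γ * u K α β γ * u K α β γ =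
    α • (u K α β γ * d K α β γ * u K α β γ) + β • (u K α β γ * u K α β γ * d K α β γ) +
      γ • u K α β γ := by
  simpa [d, u] using RingQuot.mkAlgHom_rel K (DownUpRel.rel2 (K := K) (α := α) (β := β) (γ := γ))

/-- A subspace stable under `d` and `u` is a submodule. -/
theorem smul_mem_of_stable {M : Type*} [AddCommGroup M] [Module K M] [Module (DownUp K α β γ) M]
    [IsScalarTower K (DownUp K α β γ) M] {S : Submodule K M}
    (hd : ∀ x ∈ S, d K α β γ • x ∈ S) (hu : ∀ x ∈ S, u K α β γ • x ∈ S)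
    (a : DownUp K α β γ) {x : M} (hx : x ∈ S) : a • x ∈ S := by
  obtain ⟨b, rfl⟩ := RingQuot.mkAlgHom_surjective K (DownUpRel K α β γ) a
  induction b using FreeAlgebra.induction generalizing x with
  | grade0 r =>
    rw [AlgHom.commutes, algebraMap_smul]
    exact S.smul_mem r hx
  | grade1 i =>
    fin_cases i
    · exact hd x hx
    · exact hu x hx
  | mul a b ha hb =>
    rw [map_mul, mul_smul]
    exact ha (hb hx)
  | add a b ha hb =>
    rw [map_add, add_smul]
    exact S.add_mem (ha hx) (hb hx)

/-- The operators of a module over `A(1 + η, -η, γ)` after shifting `[d, u]` by the scalar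
`γ / (1 - η)`. -/
theorem isDownUpTriple {η γ : K} (hroot : ∃ k : ℕ, 0 < k ∧ η ^ k = 1) (hη1 : η ≠ 1)
    (hγ : γ ≠ 0) (M : Type*) [AddCommGroup M] [Module K M] [Module (DownUp K (1 + η) (-η) γ) M]
    [IsScalarTower K (DownUp K (1 + η) (-η) γ) M] :
    let D := Algebra.lsmul K K M (d K (1 + η) (-η) γ)
    let U := Algebra.lsmul K K M (u K (1 + η) (-η) γ)
    IsDownUpTriple (γ / (1 - η)) η D U (D * U - U * D - algebraMap K _ (γ / (1 - η))) := by
  intro D U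
  have h1 : 1 - η ≠ 0 := sub_ne_zero.2 hη1.symm
  have hc : γ = (1 - η) * (γ / (1 - η)) := by field_simp
  have hddu (v : M) : D (D (U v)) = (1 + η) • D (U (D v)) + (-η) • U (D (D v)) + γ • D v := by
    have := congrArg (fun a => Algebra.lsmul K K M a v)
      (d_mul_d_mul_u (α := 1 + η) (β := -η) (γ := γ))
    simpa only [map_add, map_smul, map_mul, LinearMap.add_apply, LinearMap.smul_apply,
      Module.End.mul_apply] using this
  have hduu (v : M) : D (U (U v)) = (1 + η) • U (D (U v)) + (-η) • U (U (D v)) + γ • U v := by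
    have := congrArg (fun a => Algebra.lsmul K K M a v)
      (d_mul_u_mul_u (α := 1 + η) (β := -η) (γ := γ))
    simpa only [map_add, map_smul, map_mul, LinearMap.add_apply, LinearMap.smul_apply,
      Module.End.mul_apply] using this
  generalize γ / (1 - η) = c at hc
  subst hc
  refine ⟨right_ne_zero_of_mul hγ, hη1, hroot, fun v => ?_, fun v => ?_, fun v => ?_⟩
  · simp only [LinearMap.sub_apply, Module.End.mul_apply, Module.algebraMap_end_apply]
    abel
  · simp only [LinearMap.sub_apply, Module.End.mul_apply, Module.algebraMap_end_apply, map_sub,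
      map_smul, hddu]
    module
  · simp only [LinearMap.sub_apply, Module.End.mul_apply, Module.algebraMap_end_apply, map_sub,
      map_smul, hduu]
    module

end DownUp

/-- for `A_η = A(1+η, −η, γ)` with `η ≠ 1` a root of unity,
`γ ≠ 0`, over an algebraically closed field of characteristic `0`, every
finite-dimensional left `A_η`-module is semisimple. -/
theorem downUp_eta_root_of_unity_semisimple (K : Type) [Field K] [IsAlgClosed K]
    [CharZero K] (η γ : K) (hroot : ∃ k : ℕ, 0 < k ∧ η ^ k = 1) (hη1 : η ≠ 1)
    (hγ : γ ≠ 0)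
    (M : Type) [AddCommGroup M] [Module K M] [Module (DownUp K (1 + η) (-η) γ) M]
    [IsScalarTower K (DownUp K (1 + η) (-η) γ) M] [FiniteDimensional K M] :
    IsSemisimpleModule (DownUp K (1 + η) (-η) γ) M := by
  have h := DownUp.isDownUpTriple hroot hη1 hγ M
  extract_lets D U at h
  set W : Module.End K M := D * U - U * D - algebraMap K _ (γ / (1 - η))
  refine .of_sSup_simples_eq_top ?_
  let S := (sSup {m : Submodule (DownUp K (1 + η) (-η) γ) M |
    IsSimpleModule (DownUp K (1 + η) (-η) γ) m}).restrictScalars K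
  suffices S = ⊤ from (Submodule.restrictScalars_eq_top_iff K _ _).1 this
  have hUS : ∀ v ∈ S, U v ∈ S := fun v hv =>
    Submodule.smul_mem (sSup _) (DownUp.u K (1 + η) (-η) γ) hv
  refine h.eq_top_of_ker_down_le hUS
    (h.ker_down_le_iSup.trans (iSup_le ?_))
  rintro t v ⟨hDv, hWv⟩
  replace hDv : D v = 0 := hDv
  replace hWv : W v = t • v := Module.End.mem_eigenspace_iff.1 hWv
  rcases eq_or_ne v 0 with rfl | hv0
  · exact S.zero_mem
  let L : Submodule (DownUp K (1 + η) (-η) γ) M :=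
    { IsDownUpTriple.chain U v with
      smul_mem' := fun a _ hx => DownUp.smul_mem_of_stable
        (fun _ => h.down_mem_chain hDv hWv) (fun _ => IsDownUpTriple.up_mem_chain) a hx }
  have hvL : v ∈ L := IsDownUpTriple.self_mem_chain v
  have hL : IsAtom L := by
    refine ⟨fun hbot => hv0 (by simpa [hbot] using hvL), fun P hP => ?_⟩
    by_contra hne
    obtain ⟨x, hx, hx0⟩ := Submodule.exists_mem_ne_zero_of_ne_bot hne
    have hvP : v ∈ P := h.mem_of_mem_chain hDv hWv (S := P.restrictScalars K)
      (fun y hy => P.smul_mem _ hy) (hP.le hx) hx0 hx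
    refine hP.not_ge ?_
    have hle : IsDownUpTriple.chain U v ≤ P.restrictScalars K := by
      refine Submodule.span_le.2 ?_
      rintro _ ⟨k, rfl⟩
      have hpow (j : ℕ) : (U ^ j) v ∈ P := by
        induction j with
        | zero => exact hvP
        | succ j ih =>
          rw [pow_succ', Module.End.mul_apply]
          exact P.smul_mem _ ih
      exact hpow k
    exact hle
  exact (le_sSup (isSimpleModule_iff_isAtom.2 hL) : L ≤ _) hvL
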